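/- For every directed graph Q there exists an operator algebra OA(Q), unique up to completely isometric isomorphism, together with a contractive representation ι: Q → OA(Q) such that (1) ι(Q) generates OA(Q) as an operator algebra, and (2) for every operator algebra A and every contractive representation φ: Q → A there is a unique completely contractive homomorphism φ̃: OA(Q) → A with φ̃ ∘ ι = φ. -/

import Mathlib

noncomputable section

open scoped Classical

/-! ## Operator algebras, concretely represented -/

/-- A (concrete) operator algebra: a norm-closed subalgebra of the bounded
operators on a complex Hilbert space. -/
structure OpAlg where
  H : Type
  [nacg : NormedAddCommGroup H]
  [ips : InnerProductSpace ℂ H]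
  [cs : CompleteSpace H]
  carrier : NonUnitalSubalgebra ℂ (H →L[ℂ] H)
  isClosed : IsClosed (carrier : Set (H →L[ℂ] H))

attribute [instance] OpAlg.nacg OpAlg.ips OpAlg.cs

/-- The amplification of an `n × n` matrix of operators on `H` to an operator on
`H ⊕₂ ⋯ ⊕₂ H` (`n` summands, with the Hilbert space norm). -/
def matAmp {H : Type} [NormedAddCommGroup H] [InnerProductSpace ℂ H]
    {n : ℕ} (a : Matrix (Fin n) (Fin n) (H →L[ℂ] H)) :
    (PiLp 2 fun _ : Fin n => H) →L[ℂ] (PiLp 2 fun _ : Fin n => H) :=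
  ((PiLp.continuousLinearEquiv 2 ℂ fun _ : Fin n => H).symm.toContinuousLinearMap.comp
    (ContinuousLinearMap.pi fun i => ∑ j, (a i j).comp (ContinuousLinearMap.proj j))).comp
    (PiLp.continuousLinearEquiv 2 ℂ fun _ : Fin n => H).toContinuousLinearMap

/-- The matrix norm of a matrix over a concrete operator algebra. -/
def matNorm (A : OpAlg) {n : ℕ} (a : Matrix (Fin n) (Fin n) A.carrier) : ℝ :=
  ‖matAmp fun i j => (a i j : A.H →L[ℂ] A.H)‖

/-- A completely contractive homomorphism of operator algebras. -/
structure CCHom (A B : OpAlg) where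
  toHom : A.carrier →ₙₐ[ℂ] B.carrier
  completelyContractive : ∀ (n : ℕ) (a : Matrix (Fin n) (Fin n) A.carrier),
    matNorm B (fun i j => toHom (a i j)) ≤ matNorm A a

/-- A completely isometric homomorphism. -/
def CCHom.CompletelyIsometric {A B : OpAlg} (φ : CCHom A B) : Prop :=
  ∀ (n : ℕ) (a : Matrix (Fin n) (Fin n) A.carrier),
    matNorm B (fun i j => φ.toHom (a i j)) = matNorm A a

/-- Two operator algebras are completely isometrically isomorphic if there is a
bijective completely isometric homomorphism between them. -/
def CIIso (A B : OpAlg) : Prop :=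
  ∃ φ : CCHom A B, Function.Bijective φ.toHom ∧ φ.CompletelyIsometric

/-! ## Directed graphs -/

/-- A directed graph: vertices, edges, and source and range maps. -/
structure DiGraph where
  V : Type
  E : Type
  s : E → V
  r : E → V

/-- A contractive representation of a directed graph in an operator algebra:
vertices go to (self-adjoint) projections, edges go to contractions, compatibly
with the range and source maps. -/
structure GraphRep (Q : DiGraph) (A : OpAlg) where
  v : Q.V → A.carrier
  e : Q.E → A.carrier
  idem : ∀ x, v x * v x = v x
  selfAdjoint : ∀ x, IsSelfAdjoint (v x : A.H →L[ℂ] A.H)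
  contractive : ∀ x, ‖(e x : A.H →L[ℂ] A.H)‖ ≤ 1
  range_mul : ∀ x, v (Q.r x) * e x = e x
  mul_source : ∀ x, e x * v (Q.s x) = e x

/-- The representation generates the operator algebra. -/
def GraphRep.Generates {Q : DiGraph} {A : OpAlg} (ρ : GraphRep Q A) : Prop :=
  closure ((NonUnitalAlgebra.adjoin ℂ (Set.range ρ.v ∪ Set.range ρ.e) :
    NonUnitalSubalgebra ℂ A.carrier) : Set A.carrier) = Set.univ

/-- A homomorphism extends (intertwines) two representations of the same graph. -/
def ExtendsRep {Q : DiGraph} {A B : OpAlg} (ψ : CCHom A B)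
    (ρ : GraphRep Q A) (σ : GraphRep Q B) : Prop :=
  (∀ x, ψ.toHom (ρ.v x) = σ.v x) ∧ (∀ x, ψ.toHom (ρ.e x) = σ.e x)

/-- `(A, ι)` is *the* universal operator algebra of the directed graph `Q`:
`ι` generates, and every contractive representation of `Q` factors uniquely
through a completely contractive homomorphism. -/
def IsUniversalOA (Q : DiGraph) (A : OpAlg) (ι : GraphRep Q A) : Prop :=
  ι.Generates ∧
    ∀ (B : OpAlg) (σ : GraphRep Q B), ∃! ψ : CCHom A B, ExtendsRep ψ ι σ

/-! ## Matrix amplifications -/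

@[simp]
theorem matAmp_apply {H : Type} [NormedAddCommGroup H] [InnerProductSpace ℂ H] {n : ℕ}
    (a : Matrix (Fin n) (Fin n) (H →L[ℂ] H)) (x : PiLp 2 fun _ : Fin n => H) (i : Fin n) :
    matAmp a x i = ∑ j, a i j (x j) := by
  simp [matAmp]

theorem continuous_matAmp {H : Type} [NormedAddCommGroup H] [InnerProductSpace ℂ H] {n : ℕ} :
    Continuous (matAmp : Matrix (Fin n) (Fin n) (H →L[ℂ] H) → _) := by
  have key : (matAmp : Matrix (Fin n) (Fin n) (H →L[ℂ] H) → _) = fun a => ∑ i, ∑ j,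
      (((PiLp.continuousLinearEquiv 2 ℂ fun _ : Fin n => H).symm.toContinuousLinearMap.comp
        (ContinuousLinearMap.single ℂ (fun _ : Fin n => H) i)).comp (a i j)).comp
        (PiLp.proj 2 (fun _ : Fin n => H) j) := by
    funext a
    ext x k
    simp [Pi.single_apply, Finset.sum_apply]
  rw [key]
  have : ContinuousAdd ((PiLp 2 fun _ : Fin n => H) →L[ℂ] (PiLp 2 fun _ : Fin n => H)) :=
    IsTopologicalAddGroup.toContinuousAdd
  refine continuous_finsetSum _ fun i _ => continuous_finsetSum _ fun j _ => ?_
  have : Continuous fun a : Matrix (Fin n) (Fin n) (H →L[ℂ] H) => a i j :=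
    continuous_id.matrix_elem i j
  fun_prop

/-- Amplified norms do not increase under restriction to an isometrically embedded
invariant subspace. -/
theorem norm_matAmp_le_of_intertwine {H K : Type} [NormedAddCommGroup H] [InnerProductSpace ℂ H]
    [NormedAddCommGroup K] [InnerProductSpace ℂ K] {n : ℕ} (J : H →ₗᵢ[ℂ] K)
    (a : Matrix (Fin n) (Fin n) (H →L[ℂ] H)) (b : Matrix (Fin n) (Fin n) (K →L[ℂ] K))
    (h : ∀ i j x, b i j (J x) = J (a i j x)) : ‖matAmp a‖ ≤ ‖matAmp b‖ := by
  have hJ : ∀ x : PiLp 2 fun _ : Fin n => H,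
      ‖(WithLp.toLp 2 fun i => J (x i) : PiLp 2 fun _ : Fin n => K)‖ = ‖x‖ := fun x => by
    simp [PiLp.norm_eq_of_L2]
  refine ContinuousLinearMap.opNorm_le_bound _ (norm_nonneg (matAmp b)) fun x => ?_
  rw [← hJ, ← hJ x]
  have hab : (WithLp.toLp 2 fun i => J (matAmp a x i) : PiLp 2 fun _ : Fin n => K) =
      matAmp b (WithLp.toLp 2 fun i => J (x i)) := by
    ext i
    simp [h]
  rw [hab]
  exact (matAmp b).le_opNorm _

theorem norm_matAmp_one {H : Type} [NormedAddCommGroup H] [InnerProductSpace ℂ H]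
    (a : H →L[ℂ] H) : ‖matAmp (n := 1) fun _ _ => a‖ = ‖a‖ := by
  have hs : ∀ x : PiLp 2 fun _ : Fin 1 => H, ‖x‖ = ‖x 0‖ := fun x => by
    simp [PiLp.norm_eq_of_L2]
  have hamp : ∀ x : PiLp 2 fun _ : Fin 1 => H, matAmp (n := 1) (fun _ _ => a) x 0 = a (x 0) :=
    fun x => (matAmp_apply _ x 0).trans (Fin.sum_univ_one _)
  refine le_antisymm (ContinuousLinearMap.opNorm_le_bound _ (norm_nonneg a) fun x => ?_)
    (ContinuousLinearMap.opNorm_le_bound _ (norm_nonneg (matAmp (n := 1) fun _ _ => a)) fun x => ?_)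
  · rw [hs, hs x]
    rw [hamp]
    exact a.le_opNorm (x 0)
  · have := (matAmp (n := 1) fun _ _ => a).le_opNorm (WithLp.toLp 2 fun _ => x)
    rwa [hs, hs (WithLp.toLp 2 fun _ => x), hamp] at this

instance (A : OpAlg) : IsBoundedSMul ℂ A.carrier :=
  IsBoundedSMul.of_norm_smul_le fun c a => norm_smul_le c (a : A.H →L[ℂ] A.H)

theorem matNorm_one (A : OpAlg) (a : A.carrier) : matNorm A (n := 1) (fun _ _ => a) = ‖a‖ :=
  norm_matAmp_one _

theorem continuous_matNorm (A : OpAlg) {n : ℕ} :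
    Continuous (matNorm A : Matrix (Fin n) (Fin n) A.carrier → ℝ) := by
  refine continuous_norm.comp (continuous_matAmp.comp ?_)
  exact continuous_matrix fun i j => continuous_subtype_val.comp (continuous_id.matrix_elem i j)

/-! ## Completely contractive homomorphisms -/

namespace CCHom

theorem ext {A B : OpAlg} {φ ψ : CCHom A B} (h : φ.toHom = ψ.toHom) : φ = ψ := by
  cases φ
  cases ψ
  congr

/-- The identity homomorphism. -/
def id (A : OpAlg) : CCHom A A where
  toHom := NonUnitalAlgHom.id ℂ A.carrier
  completelyContractive _ _ := le_rfl

/-- The composition of completely contractive homomorphisms. -/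
def comp {A B C : OpAlg} (ψ : CCHom B C) (φ : CCHom A B) : CCHom A C where
  toHom := ψ.toHom.comp φ.toHom
  completelyContractive n a :=
    (ψ.completelyContractive n _).trans (φ.completelyContractive n a)

theorem norm_le {A B : OpAlg} (φ : CCHom A B) (a : A.carrier) : ‖φ.toHom a‖ ≤ ‖a‖ := by
  simpa only [matNorm_one] using φ.completelyContractive 1 fun _ _ => a

theorem continuous {A B : OpAlg} (φ : CCHom A B) : Continuous φ.toHom :=
  AddMonoidHomClass.continuous_of_bound φ.toHom 1 fun a => by simpa using φ.norm_le a

end CCHom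

theorem FreeNonUnitalNonAssocAlgebra.mem_of_forall_of_mem {X : Type}
    (S : NonUnitalSubalgebra ℂ (FreeNonUnitalNonAssocAlgebra ℂ X))
    (h : ∀ x, FreeNonUnitalNonAssocAlgebra.of ℂ x ∈ S) (f : FreeNonUnitalNonAssocAlgebra ℂ X) :
    f ∈ S := by
  have key : (NonUnitalSubalgebraClass.subtype S).comp
      (lift ℂ fun x => (⟨of ℂ x, h x⟩ : S)) =
      NonUnitalAlgHom.id ℂ (FreeNonUnitalNonAssocAlgebra ℂ X) := by
    apply hom_ext
    intro x
    simp
  have := congrArg (fun g => g f) key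
  simp only [NonUnitalAlgHom.comp_apply, NonUnitalAlgHom.coe_id, _root_.id] at this
  rw [← this]
  exact Subtype.property _

/-! ## Graph representations -/

namespace GraphRep

variable {Q : DiGraph} {A : OpAlg}

/-- The homomorphism out of the free algebra on the vertices and edges. -/
def hom (ρ : GraphRep Q A) : FreeNonUnitalNonAssocAlgebra ℂ (Q.V ⊕ Q.E) →ₙₐ[ℂ] A.carrier :=
  FreeNonUnitalNonAssocAlgebra.lift ℂ (Sum.elim ρ.v ρ.e)

@[simp]
theorem hom_vertex (ρ : GraphRep Q A) (x : Q.V) :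
    ρ.hom (FreeNonUnitalNonAssocAlgebra.of ℂ (Sum.inl x)) = ρ.v x := by
  simp [hom]

@[simp]
theorem hom_edge (ρ : GraphRep Q A) (x : Q.E) :
    ρ.hom (FreeNonUnitalNonAssocAlgebra.of ℂ (Sum.inr x)) = ρ.e x := by
  simp [hom]

/-- The matrix norms that a representation induces on the free algebra. -/
def freeMatNorm (ρ : GraphRep Q A) (n : ℕ)
    (a : Matrix (Fin n) (Fin n) (FreeNonUnitalNonAssocAlgebra ℂ (Q.V ⊕ Q.E))) : ℝ :=
  matNorm A fun i j => ρ.hom (a i j)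

theorem Generates.denseRange_hom {ρ : GraphRep Q A} (h : ρ.Generates) : DenseRange ρ.hom := by
  rw [DenseRange, dense_iff_closure_eq, ← Set.univ_subset_iff, ← h]
  refine closure_mono ?_
  have : NonUnitalAlgebra.adjoin ℂ (Set.range ρ.v ∪ Set.range ρ.e) ≤
      NonUnitalAlgHom.range ρ.hom := by
    refine NonUnitalAlgebra.adjoin_le ?_
    rintro _ (⟨x, rfl⟩ | ⟨x, rfl⟩)
    · exact ⟨_, ρ.hom_vertex x⟩
    · exact ⟨_, ρ.hom_edge x⟩
  exact this

theorem generates_of_denseRange_hom {ρ : GraphRep Q A} (h : DenseRange ρ.hom) :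
    ρ.Generates := by
  rw [Generates, ← Set.univ_subset_iff, ← h.closure_range]
  refine closure_mono ?_
  rintro _ ⟨f, rfl⟩
  refine FreeNonUnitalNonAssocAlgebra.mem_of_forall_of_mem
    ((NonUnitalAlgebra.adjoin ℂ (Set.range ρ.v ∪ Set.range ρ.e)).comap ρ.hom) ?_ f
  rintro (x | x)
  · exact NonUnitalAlgebra.subset_adjoin ℂ (Or.inl ⟨x, (ρ.hom_vertex x).symm⟩)
  · exact NonUnitalAlgebra.subset_adjoin ℂ (Or.inr ⟨x, (ρ.hom_edge x).symm⟩)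

theorem hom_eq_of_extendsRep {B : OpAlg} {ψ : CCHom A B} {ρ : GraphRep Q A} {σ : GraphRep Q B}
    (h : ExtendsRep ψ ρ σ) : ψ.toHom.comp ρ.hom = σ.hom := by
  apply FreeNonUnitalNonAssocAlgebra.hom_ext
  intro x
  rcases x with x | x
  · simpa using h.1 x
  · simpa using h.2 x

theorem Generates.eq_of_extendsRep {B : OpAlg} {ρ : GraphRep Q A} {σ : GraphRep Q B}
    (hρ : ρ.Generates) {φ ψ : CCHom A B} (hφ : ExtendsRep φ ρ σ) (hψ : ExtendsRep ψ ρ σ) :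
    φ = ψ := by
  apply CCHom.ext
  apply DFunLike.coe_injective
  refine hρ.denseRange_hom.equalizer φ.continuous ψ.continuous ?_
  funext f
  have := (hom_eq_of_extendsRep hφ).trans (hom_eq_of_extendsRep hψ).symm
  exact DFunLike.congr_fun this f

/-- A generating representation that dominates the matrix norms of `σ` admits a completely
contractive homomorphism extending `σ`. -/
theorem Generates.exists_extendsRep {B : OpAlg} {ρ : GraphRep Q A} {σ : GraphRep Q B}
    (hρ : ρ.Generates) (hle : ∀ n a, σ.freeMatNorm n a ≤ ρ.freeMatNorm n a) :
    ∃ ψ : CCHom A B, ExtendsRep ψ ρ σ := by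
  have hd : DenseRange ρ.hom := hρ.denseRange_hom
  have : CompleteSpace B.carrier := B.isClosed.completeSpace_coe
  have hn : ∀ f, ‖σ.hom f‖ ≤ 1 * ‖ρ.hom f‖ := fun f => by
    simpa only [freeMatNorm, matNorm_one, one_mul] using hle 1 fun _ _ => f
  let g : FreeNonUnitalNonAssocAlgebra ℂ (Q.V ⊕ Q.E) →ₗ[ℂ] B.carrier := σ.hom
  let e : FreeNonUnitalNonAssocAlgebra ℂ (Q.V ⊕ Q.E) →ₗ[ℂ] A.carrier := ρ.hom
  let L : A.carrier →L[ℂ] B.carrier := g.extendOfNorm e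
  have hL : ∀ f, L (ρ.hom f) = σ.hom f :=
    LinearMap.extendOfNorm_eq (f := g) (e := e) hd ⟨1, hn⟩
  have hmul : ∀ a b, L (a * b) = L a * L b := fun a b => by
    refine hd.induction_on₂ (p := fun a b => L (a * b) = L a * L b)
      (isClosed_eq (by fun_prop) (by fun_prop)) (fun f g => ?_) a b
    rw [← map_mul, hL, hL, hL, map_mul]
  refine ⟨⟨{ (L : A.carrier →ₗ[ℂ] B.carrier) with
      map_zero' := map_zero L, map_mul' := hmul }, fun n a => ?_⟩, fun x => ?_, fun x => ?_⟩
  · change matNorm B (fun i j => L (a i j)) ≤ matNorm A a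
    have hdm : DenseRange fun (m : Fin n → Fin n → _) i j => ρ.hom (m i j) :=
      DenseRange.piMap fun _ => DenseRange.piMap fun _ => hd
    refine hdm.induction_on (p := fun a => matNorm B (fun i j => L (a i j)) ≤ matNorm A a) a
      (isClosed_le ?_ (continuous_matNorm A)) fun m => ?_
    · refine (continuous_matNorm B).comp (continuous_pi fun i => continuous_pi fun j => ?_)
      fun_prop
    · simp only [hL]
      exact hle n m
  · exact (congrArg L (ρ.hom_vertex x)).symm.trans ((hL _).trans (σ.hom_vertex x))
  · exact (congrArg L (ρ.hom_edge x)).symm.trans ((hL _).trans (σ.hom_edge x))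

theorem Generates.isUniversalOA {ρ : GraphRep Q A} (hρ : ρ.Generates)
    (hle : ∀ (B : OpAlg) (σ : GraphRep Q B) n a, σ.freeMatNorm n a ≤ ρ.freeMatNorm n a) :
    IsUniversalOA Q A ρ := by
  refine ⟨hρ, fun B σ => ?_⟩
  obtain ⟨ψ, hψ⟩ := hρ.exists_extendsRep (hle B σ)
  exact ⟨ψ, hψ, fun φ hφ => hρ.eq_of_extendsRep hφ hψ⟩

theorem norm_vertex_le (ρ : GraphRep Q A) (x : Q.V) : ‖(ρ.v x : A.H →L[ℂ] A.H)‖ ≤ 1 := by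
  have : IsStarProjection (ρ.v x : A.H →L[ℂ] A.H) :=
    ⟨congrArg Subtype.val (ρ.idem x), ρ.selfAdjoint x⟩
  exact this.norm_le

end GraphRep

/-! ## Direct sums -/

section DirectSum

variable {I : Type} {G : I → Type} [∀ i, NormedAddCommGroup (G i)]
  [∀ i, InnerProductSpace ℂ (G i)]

/-- The block diagonal operator of a family of contractions on a Hilbert sum. -/
def diagOp (T : ∀ i, G i →L[ℂ] G i) (hT : ∀ i, ‖T i‖ ≤ 1) : lp G 2 →L[ℂ] lp G 2 :=
  LinearMap.mkContinuous
    { toFun := fun x => ⟨fun i => T i (x i),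
        (lp.memℓp x).mono' fun i => (T i).le_of_opNorm_le (hT i) (x i) |>.trans (by simp)⟩
      map_add' := fun x y => by
        ext i
        exact map_add (T i) (x i) (y i)
      map_smul' := fun c x => by
        ext i
        exact map_smul (T i) c (x i) }
    1 fun x => by
      rw [one_mul]
      exact lp.norm_mono (by simp) fun i => (T i).le_of_opNorm_le (hT i) (x i) |>.trans (by simp)

@[simp]
theorem diagOp_apply (T : ∀ i, G i →L[ℂ] G i) (hT : ∀ i, ‖T i‖ ≤ 1) (x : lp G 2) (i : I) :
    diagOp T hT x i = T i (x i) :=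
  rfl

theorem norm_diagOp_le (T : ∀ i, G i →L[ℂ] G i) (hT : ∀ i, ‖T i‖ ≤ 1) : ‖diagOp T hT‖ ≤ 1 :=
  LinearMap.mkContinuous_norm_le _ zero_le_one _

theorem diagOp_single (T : ∀ i, G i →L[ℂ] G i) (hT : ∀ i, ‖T i‖ ≤ 1) (i : I) (x : G i) :
    diagOp T hT (lp.single 2 i x) = lp.single 2 i (T i x) := by
  ext j
  rw [diagOp_apply]
  by_cases h : j = i
  · subst h
    simp
  · simp [h]

theorem isSelfAdjoint_diagOp [∀ i, CompleteSpace (G i)] (T : ∀ i, G i →L[ℂ] G i)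
    (hT : ∀ i, ‖T i‖ ≤ 1) (h : ∀ i, IsSelfAdjoint (T i)) : IsSelfAdjoint (diagOp T hT) := by
  rw [ContinuousLinearMap.isSelfAdjoint_iff_isSymmetric]
  intro x y
  simp only [lp.inner_eq_tsum]
  refine tsum_congr fun i => ?_
  exact (ContinuousLinearMap.isSelfAdjoint_iff_isSymmetric.mp (h i)) (x i) (y i)

end DirectSum

section SumRep

variable {Q : DiGraph} {I : Type} {A : I → OpAlg} (ρ : ∀ i, GraphRep Q (A i))

/-- The direct sum of the operators representing a vertex or an edge. -/
def sumGen (x : Q.V ⊕ Q.E) :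
    lp (fun i => (A i).H) 2 →L[ℂ] lp (fun i => (A i).H) 2 :=
  match x with
  | Sum.inl v => diagOp (fun i => ((ρ i).v v : (A i).H →L[ℂ] (A i).H))
      fun i => (ρ i).norm_vertex_le v
  | Sum.inr e => diagOp (fun i => ((ρ i).e e : (A i).H →L[ℂ] (A i).H))
      fun i => (ρ i).contractive e

/-- The operator algebra generated by a direct sum of graph representations. -/
def sumAlg : OpAlg where
  H := lp (fun i => (A i).H) 2
  carrier := (NonUnitalAlgHom.range
    (FreeNonUnitalNonAssocAlgebra.lift ℂ (sumGen ρ))).topologicalClosure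
  isClosed := NonUnitalSubalgebra.isClosed_topologicalClosure _

theorem sumGen_mem (x : Q.V ⊕ Q.E) : sumGen ρ x ∈ (sumAlg ρ).carrier :=
  NonUnitalSubalgebra.le_topologicalClosure _
    ⟨FreeNonUnitalNonAssocAlgebra.of ℂ x, FreeNonUnitalNonAssocAlgebra.lift_of_apply ..⟩

/-- The direct sum of graph representations. -/
def sumRep : GraphRep Q (sumAlg ρ) where
  v x := ⟨sumGen ρ (Sum.inl x), sumGen_mem ρ _⟩
  e x := ⟨sumGen ρ (Sum.inr x), sumGen_mem ρ _⟩
  idem x := by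
    refine Subtype.ext (ContinuousLinearMap.ext fun (y : lp (fun i => (A i).H) 2) =>
      lp.ext (funext fun i => ?_))
    exact DFunLike.congr_fun (congrArg Subtype.val ((ρ i).idem x)) (y i)
  selfAdjoint x := isSelfAdjoint_diagOp _ (fun i => (ρ i).norm_vertex_le x)
    fun i => (ρ i).selfAdjoint x
  contractive x := norm_diagOp_le _ fun i => (ρ i).contractive x
  range_mul x := by
    refine Subtype.ext (ContinuousLinearMap.ext fun (y : lp (fun i => (A i).H) 2) =>
      lp.ext (funext fun i => ?_))
    exact DFunLike.congr_fun (congrArg Subtype.val ((ρ i).range_mul x)) (y i)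
  mul_source x := by
    refine Subtype.ext (ContinuousLinearMap.ext fun (y : lp (fun i => (A i).H) 2) =>
      lp.ext (funext fun i => ?_))
    exact DFunLike.congr_fun (congrArg Subtype.val ((ρ i).mul_source x)) (y i)

theorem sumRep_hom_coe (f : FreeNonUnitalNonAssocAlgebra ℂ (Q.V ⊕ Q.E)) :
    ((sumRep ρ).hom f : (sumAlg ρ).H →L[ℂ] (sumAlg ρ).H) =
      FreeNonUnitalNonAssocAlgebra.lift ℂ (sumGen ρ) f := by
  have : (NonUnitalSubalgebraClass.subtype (sumAlg ρ).carrier).comp (sumRep ρ).hom =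
      FreeNonUnitalNonAssocAlgebra.lift ℂ (sumGen ρ) := by
    apply FreeNonUnitalNonAssocAlgebra.hom_ext
    intro x
    refine Eq.trans ?_ (FreeNonUnitalNonAssocAlgebra.lift_of_apply ℂ (sumGen ρ) x).symm
    rcases x with x | x
    · exact congrArg Subtype.val ((sumRep ρ).hom_vertex x)
    · exact congrArg Subtype.val ((sumRep ρ).hom_edge x)
  exact DFunLike.congr_fun this f

theorem sumRep_generates : (sumRep ρ).Generates := by
  refine GraphRep.generates_of_denseRange_hom fun a => ?_
  rw [closure_subtype]
  have h : (a : (sumAlg ρ).H →L[ℂ] (sumAlg ρ).H) ∈ closure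
      (Set.range (FreeNonUnitalNonAssocAlgebra.lift ℂ (sumGen ρ))) := a.2
  rw [← Set.range_comp]
  exact (funext (sumRep_hom_coe ρ) : Subtype.val ∘ (sumRep ρ).hom = _) ▸ h

theorem sumRep_hom_single (i : I) (f : FreeNonUnitalNonAssocAlgebra ℂ (Q.V ⊕ Q.E))
    (x : (A i).H) :
    FreeNonUnitalNonAssocAlgebra.lift ℂ (sumGen ρ) f (lp.single 2 i x) =
      lp.single 2 i (((ρ i).hom f : (A i).H →L[ℂ] (A i).H) x) := by
  let S : NonUnitalSubalgebra ℂ (FreeNonUnitalNonAssocAlgebra ℂ (Q.V ⊕ Q.E)) :=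
    { carrier := {f | ∀ x : (A i).H,
        FreeNonUnitalNonAssocAlgebra.lift ℂ (sumGen ρ) f (lp.single 2 i x) =
          lp.single 2 i (((ρ i).hom f : (A i).H →L[ℂ] (A i).H) x)}
      add_mem' := fun {f g} hf hg x => by
        simp only [map_add, _root_.add_apply, NonUnitalSubalgebra.coe_add,
          lp.single_add, hf x, hg x]
      zero_mem' := fun x => by simp
      mul_mem' := fun {f g} hf hg x => by
        simp only [map_mul, mul_apply_eq_comp, NonUnitalSubalgebra.coe_mul, hg x,
          hf (((ρ i).hom g : (A i).H →L[ℂ] (A i).H) x)]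
      smul_mem' := fun c f hf x => by
        simp only [map_smul, _root_.smul_apply, NonUnitalSubalgebra.coe_smul,
          lp.single_smul, hf x] }
  refine FreeNonUnitalNonAssocAlgebra.mem_of_forall_of_mem S ?_ f x
  rintro (v | e) x
  · rw [FreeNonUnitalNonAssocAlgebra.lift_of_apply, GraphRep.hom_vertex]
    exact diagOp_single (G := fun i => (A i).H) _ (fun i => (ρ i).norm_vertex_le v) i x
  · rw [FreeNonUnitalNonAssocAlgebra.lift_of_apply, GraphRep.hom_edge]
    exact diagOp_single (G := fun i => (A i).H) _ (fun i => (ρ i).contractive e) i x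

theorem freeMatNorm_le_sumRep (i : I) (n : ℕ)
    (a : Matrix (Fin n) (Fin n) (FreeNonUnitalNonAssocAlgebra ℂ (Q.V ⊕ Q.E))) :
    (ρ i).freeMatNorm n a ≤ (sumRep ρ).freeMatNorm n a := by
  let J : (A i).H →ₗᵢ[ℂ] (sumAlg ρ).H :=
    ⟨lp.lsingle (E := fun i => (A i).H) 2 i,
      fun x => lp.norm_single (E := fun i => (A i).H) (by simp) i x⟩
  refine norm_matAmp_le_of_intertwine J _ _ fun k l x => ?_
  rw [sumRep_hom_coe]
  exact sumRep_hom_single ρ i (a k l) x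

end SumRep

/-- The matrix norms on the free algebra form a small set, so that one direct sum dominates
all representations. -/
theorem exists_isUniversalOA (Q : DiGraph) :
    ∃ (A : OpAlg) (ι : GraphRep Q A), IsUniversalOA Q A ι := by
  let I : Type := {N // ∃ (A : OpAlg) (ρ : GraphRep Q A), ρ.freeMatNorm = N}
  choose A ρ hρ using fun i : I => i.2
  refine ⟨sumAlg ρ, sumRep ρ, (sumRep_generates ρ).isUniversalOA fun B σ n a => ?_⟩
  have h := freeMatNorm_le_sumRep ρ ⟨σ.freeMatNorm, B, σ, rfl⟩ n a
  rwa [hρ] at h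

theorem ExtendsRep.comp {Q : DiGraph} {A B C : OpAlg} {ψ : CCHom B C} {φ : CCHom A B}
    {ρ : GraphRep Q A} {σ : GraphRep Q B} {τ : GraphRep Q C} (hψ : ExtendsRep ψ σ τ)
    (hφ : ExtendsRep φ ρ σ) : ExtendsRep (ψ.comp φ) ρ τ :=
  ⟨fun x => (congrArg ψ.toHom (hφ.1 x)).trans (hψ.1 x),
    fun x => (congrArg ψ.toHom (hφ.2 x)).trans (hψ.2 x)⟩

theorem GraphRep.Generates.leftInverse {Q : DiGraph} {A B : OpAlg} {ρ : GraphRep Q A}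
    {σ : GraphRep Q B} (hρ : ρ.Generates) {φ : CCHom A B} {ψ : CCHom B A}
    (hφ : ExtendsRep φ ρ σ) (hψ : ExtendsRep ψ σ ρ) :
    Function.LeftInverse ψ.toHom φ.toHom := fun a =>
  have h : ψ.comp φ = CCHom.id A :=
    hρ.eq_of_extendsRep (hψ.comp hφ) ⟨fun _ => rfl, fun _ => rfl⟩
  DFunLike.congr_fun (congrArg CCHom.toHom h) a

/-- For every directed graph `Q` there exists a universal operator
algebra `OA(Q)` with its canonical generating representation, and it is unique up to
completely isometric isomorphism (one respecting the canonical representations). -/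
theorem exists_unique_universal_operatorAlgebra (Q : DiGraph) :
    (∃ (A : OpAlg) (ι : GraphRep Q A), IsUniversalOA Q A ι) ∧
    (∀ (A A' : OpAlg) (ι : GraphRep Q A) (ι' : GraphRep Q A'),
      IsUniversalOA Q A ι → IsUniversalOA Q A' ι' →
      ∃ ψ : CCHom A A', Function.Bijective ψ.toHom ∧ ψ.CompletelyIsometric ∧
        ExtendsRep ψ ι ι') := by
  refine ⟨exists_isUniversalOA Q, fun A A' ι ι' h h' => ?_⟩
  obtain ⟨ψ, hψ, -⟩ := h.2 A' ι'
  obtain ⟨φ, hφ, -⟩ := h'.2 A ι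
  have hl : Function.LeftInverse φ.toHom ψ.toHom := h.1.leftInverse hψ hφ
  have hr : Function.LeftInverse ψ.toHom φ.toHom := h'.1.leftInverse hφ hψ
  refine ⟨ψ, ⟨hl.injective, hr.surjective⟩, fun n a => ?_, hψ⟩
  refine le_antisymm (ψ.completelyContractive n a) ?_
  simpa only [hl _] using φ.completelyContractive n fun i j => ψ.toHom (a i j)

end
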